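/- arXiv:2407.13996 — 3 statements merged into one kernel-verified Lean document; each statement's English description precedes it below -/
import Mathlib

section
/- Let N ≥ 4 and D ≥ 1 be integers, define f_dbl(d) = 2(−N d² + (N−1) d + 2) D and f_sgl(d) = (−N d + N + 1) D for d ∈ [0,1], and let d* = ((3N − 2) − √(N² + 12N + 4)) / (4N). Then f_dbl(d) < f_sgl(d) for all d ∈ [0, d*), and f_dbl(d) > f_sgl(d) for all d ∈ (d*, 1]. That is, double masking requires fewer masks in expectation than single masking exactly when the dropout rate is below the crossover point, and more when it is above. -/
/-- Double masking requires strictly fewer expected mask generations than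
single masking exactly when the dropout rate is below the crossover point
`d* = ((3N - 2) - √(N² + 12N + 4)) / (4N)`, and strictly more above it. -/
theorem flashe_crossover_comparison (N D : ℕ) (hN : 4 ≤ N) (hD : 1 ≤ D) :
    (∀ d : ℝ, d ∈ Set.Ico (0 : ℝ)
        (((3 * (N : ℝ) - 2) - Real.sqrt ((N : ℝ) ^ 2 + 12 * (N : ℝ) + 4))
          / (4 * (N : ℝ))) →
      2 * (-(N : ℝ) * d ^ 2 + ((N : ℝ) - 1) * d + 2) * (D : ℝ)
        < (-(N : ℝ) * d + (N : ℝ) + 1) * (D : ℝ)) ∧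
    (∀ d : ℝ, d ∈ Set.Ioc
        (((3 * (N : ℝ) - 2) - Real.sqrt ((N : ℝ) ^ 2 + 12 * (N : ℝ) + 4))
          / (4 * (N : ℝ))) (1 : ℝ) →
      2 * (-(N : ℝ) * d ^ 2 + ((N : ℝ) - 1) * d + 2) * (D : ℝ)
        > (-(N : ℝ) * d + (N : ℝ) + 1) * (D : ℝ)) := by
  have hN0 : (0 : ℝ) < N := by exact_mod_cast (by omega : 0 < N)
  have hD0 : (0 : ℝ) < D := by exact_mod_cast hD
  have h4N : (0 : ℝ) < 4 * N := by positivity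
  set s := Real.sqrt ((N : ℝ) ^ 2 + 12 * (N : ℝ) + 4)
  have hs_sq : s ^ 2 = (N : ℝ) ^ 2 + 12 * (N : ℝ) + 4 := Real.sq_sqrt (by positivity)
  have hs_nonneg : 0 ≤ s := Real.sqrt_nonneg _
  have hs_gt : (N : ℝ) + 2 < s := Real.lt_sqrt_of_sq_lt (by nlinarith)
  -- Completing the square: `8N` times the difference of the two mask counts per coordinate.
  have key (d : ℝ) : 8 * (N : ℝ) * ((-(N : ℝ) * d + N + 1)
      - 2 * (-(N : ℝ) * d ^ 2 + ((N : ℝ) - 1) * d + 2))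
      = (4 * N * d - (3 * N - 2)) ^ 2 - s ^ 2 := by
    rw [hs_sq]; ring
  refine ⟨fun d hd => mul_lt_mul_of_pos_right ?_ hD0,
    fun d hd => mul_lt_mul_of_pos_right ?_ hD0⟩
  · have hlt := (lt_div_iff₀ h4N).1 hd.2
    have hpos : 0 < (4 * N * d - (3 * N - 2)) ^ 2 - s ^ 2 := by nlinarith
    rw [← key d] at hpos
    exact sub_pos.1 (pos_of_mul_pos_right hpos (by positivity))
  · have hgt := (div_lt_iff₀ h4N).1 hd.1
    have hle : 4 * N * d ≤ 4 * N := mul_le_of_le_one_right h4N.le hd.2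
    have hneg : (4 * N * d - (3 * N - 2)) ^ 2 - s ^ 2 < 0 :=
      sub_neg.2 (sq_lt_sq' (by linarith) (by linarith))
    rw [← key d] at hneg
    exact sub_neg.1 (neg_of_mul_neg_right hneg (by positivity))
end

section
/- Let N ≥ 9 and D ≥ 1 be integers and define f_dbl(d) = 2(−N d² + (N−1) d + 2) D and f_sgl(d) = (−N d + N + 1) D for d ∈ [0,1]. Then for every dropout rate d with 0 ≤ d ≤ 0.3, f_dbl(d) ≤ f_sgl(d). That is, double masking incurs no more computational overhead (expected mask generations) than single masking as long as client dropout is mild (d ≤ 0.3). -/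
/-- For `N ≥ 9` clients, updates of length `D ≥ 1`, and any mild dropout rate
`d ≤ 0.3`, double masking incurs no more expected mask generations than single
masking: `2(-N d² + (N-1) d + 2) D ≤ (-N d + N + 1) D`. -/
theorem flashe_double_beats_single_mild_dropout (N D : ℕ) (hN : 9 ≤ N)
    (hD : 1 ≤ D) :
    ∀ d : ℝ, 0 ≤ d → d ≤ 0.3 →
      2 * (-(N : ℝ) * d ^ 2 + ((N : ℝ) - 1) * d + 2) * (D : ℝ)
        ≤ (-(N : ℝ) * d + (N : ℝ) + 1) * (D : ℝ) := by
  intro d _ hd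
  norm_num at hd
  have hN' : (9 : ℝ) ≤ N := by exact_mod_cast hN
  refine mul_le_mul_of_nonneg_right ?_ (Nat.cast_nonneg D)
  -- The difference of the two sides is `N (1 - d) (1 - 2d) - 3 + 2d`, increasing in `N`.
  have hmono : 0 ≤ ((N : ℝ) - 9) * ((1 - d) * (1 - 2 * d)) :=
    mul_nonneg (by linarith) (mul_nonneg (by linarith) (by linarith))
  have hnine : 0 ≤ (3 / 10 - d) * (98 / 5 - 18 * d) :=
    mul_nonneg (by linarith) (by linarith)
  nlinarith only [hmono, hnine]
end

section
/- The crossover point d*(N) = ((3N − 2) − √(N² + 12N + 4)) / (4N) is strictly increasing in N for real N > 0; in particular, for integers 4 ≤ N < M, d*(N) < d*(M). That is, as the scale of the federation grows, the range of dropout rates for which double masking outperforms single masking expands, approaching [0, 1/2). -/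
/-- `N ↦ √(N² + 12N + 4) / N` is strictly decreasing on the positive reals, in
cross-multiplied form. -/
theorem mul_sqrt_lt_mul_sqrt_of_pos_of_lt {a b : ℝ} (ha : 0 < a) (hab : a < b) :
    a * Real.sqrt (b ^ 2 + 12 * b + 4) < b * Real.sqrt (a ^ 2 + 12 * a + 4) := by
  have hb : 0 < b := ha.trans hab
  refine lt_of_pow_lt_pow_left₀ 2 (by positivity) ?_
  rw [mul_pow, mul_pow, Real.sq_sqrt (by positivity), Real.sq_sqrt (by positivity)]
  have h : 0 < (b - a) * (12 * (a * b) + 4 * (a + b)) :=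
    mul_pos (sub_pos.2 hab) (by positivity)
  linarith

/-- The crossover point `d*(N) = ((3N - 2) - √(N² + 12N + 4)) / (4N)` is
strictly increasing in `N` over the positive reals; in particular, for integers
`4 ≤ N < M`, `d*(N) < d*(M)`. -/
theorem flashe_crossover_monotone :
    StrictMonoOn
      (fun N : ℝ => ((3 * N - 2) - Real.sqrt (N ^ 2 + 12 * N + 4)) / (4 * N))
      (Set.Ioi (0 : ℝ)) ∧
    (∀ N M : ℕ, 4 ≤ N → N < M →
      ((3 * (N : ℝ) - 2) - Real.sqrt ((N : ℝ) ^ 2 + 12 * (N : ℝ) + 4))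
          / (4 * (N : ℝ))
        < ((3 * (M : ℝ) - 2) - Real.sqrt ((M : ℝ) ^ 2 + 12 * (M : ℝ) + 4))
          / (4 * (M : ℝ))) := by
  have mono : StrictMonoOn
      (fun N : ℝ => ((3 * N - 2) - Real.sqrt (N ^ 2 + 12 * N + 4)) / (4 * N))
      (Set.Ioi (0 : ℝ)) := by
    intro a (ha : 0 < a) b (hb : 0 < b) hab
    have h := mul_sqrt_lt_mul_sqrt_of_pos_of_lt ha hab
    refine (div_lt_div_iff₀ (by positivity) (by positivity)).2 ?_
    linarith
  refine ⟨mono, fun N M hN hNM => mono ?_ ?_ (Nat.cast_lt.2 hNM)⟩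
  · exact Set.mem_Ioi.2 (Nat.cast_pos.2 (by lia))
  · exact Set.mem_Ioi.2 (Nat.cast_pos.2 (by lia))
end
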